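/- For q an odd prime power, the Sylow 2-subgroups of SL_2(F_q) are generalized quaternion groups. -/

import Mathlib

/-- Elements satisfying the defining relations of the generalized quaternion group, the first one
of full order, generate a generalized quaternion group. -/
theorem QuaternionGroup.exists_injective_monoidHom {G : Type*} [Group G] {n : ℕ} (hn : 1 < n)
    {x y : G} (hx : orderOf x = 2 * n) (hy : y ^ 2 = x ^ n) (hxy : y * x * y⁻¹ = x⁻¹) :
    ∃ f : QuaternionGroup n →* G, Function.Injective f := by
  have : NeZero n := ⟨by omega⟩
  have hcomm (k : ℕ) : x ^ k * y = y * (x ^ k)⁻¹ := by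
    have h : SemiconjBy y x⁻¹ x := by
      simpa using (show SemiconjBy y x x⁻¹ from mul_inv_eq_iff_eq_mul.mp hxy).inv_right
    rw [← inv_pow, (h.pow_right k).eq]
  let p : ZMod (2 * n) → G := fun i ↦ x ^ i.val
  have hp_add (i j) : p (i + j) = p i * p j := by
    simp only [p, ZMod.val_add, ← pow_add, ← hx, pow_mod_orderOf]
  have hp_nat : p n = y ^ 2 := by
    simp only [p, ZMod.val_natCast, hy, ← hx, pow_mod_orderOf]
  have hp_sub (i j) : p (i - j) = p i * (p j)⁻¹ := by
    rw [eq_mul_inv_iff_mul_eq, ← hp_add, sub_add_cancel]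
  have hp_comm (i) : p i * y = y * (p i)⁻¹ := hcomm _
  have hp_inj : Function.Injective p := fun i j h ↦ ZMod.val_injective _ <|
    pow_injOn_Iio_orderOf (by simpa [hx] using ZMod.val_lt i) (by simpa [hx] using ZMod.val_lt j) h
  have hp_ne (i) : p i ≠ y := by
    rintro rfl
    have h : x = x⁻¹ := by
      rw [← hxy, ((Commute.refl x).pow_left _).eq, mul_inv_cancel_right]
    have : 2 * n ∣ 2 := by
      rw [← hx, orderOf_dvd_iff_pow_eq_one, sq]
      nth_rewrite 1 [h]
      exact inv_mul_cancel x
    have := Nat.le_of_dvd two_pos this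
    omega
  let f : QuaternionGroup n → G
    | .a i => p i
    | .xa i => y * p i
  refine ⟨MonoidHom.mk' f ?_, ?_⟩
  · rintro (i | i) (j | j)
    · exact hp_add i j
    · change y * p (j - i) = p i * (y * p j)
      rw [← mul_assoc, hp_comm, mul_assoc, sub_eq_neg_add, hp_add, ← zero_sub, hp_sub]
      simp [p]
    · change y * p (i + j) = y * p i * p j
      rw [hp_add, mul_assoc]
    · change p (n + j - i) = y * p i * (y * p j)
      rw [add_sub_assoc, hp_add, hp_nat, sub_eq_neg_add, hp_add, ← zero_sub, hp_sub, mul_assoc y,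
        ← mul_assoc (p i), hp_comm]
      simp [p, sq, mul_assoc]
  · rintro (i | i) (j | j) h
    · exact congrArg QuaternionGroup.a (hp_inj h)
    · change p i = y * p j at h
      exact (hp_ne (i - j) (by rw [hp_sub, h, mul_inv_cancel_right])).elim
    · change y * p i = p j at h
      exact (hp_ne (j - i) (by rw [hp_sub, ← h, mul_inv_cancel_right])).elim
    · exact congrArg QuaternionGroup.xa (hp_inj (mul_left_cancel h))

theorem Matrix.SpecialLinearGroup.card_fin_two (F : Type*) [Field F] [Fintype F] :
    Nat.card (Matrix.SpecialLinearGroup (Fin 2) F) =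
      Fintype.card F * (Fintype.card F ^ 2 - 1) := by
  have hker : (Matrix.GeneralLinearGroup.det (n := Fin 2) (R := F)).ker =
      (Matrix.SpecialLinearGroup.toGL (n := Fin 2) (R := F)).range := by
    ext g
    constructor
    · intro hg
      exact ⟨⟨g, by simpa [Units.ext_iff] using hg⟩, Units.ext rfl⟩
    · rintro ⟨g, rfl⟩
      simp
  have hcard := (Matrix.GeneralLinearGroup.det (n := Fin 2) (R := F)).ker.card_mul_index
  rw [Subgroup.index_ker, hker, MonoidHom.range_eq_top.mpr
    Matrix.GeneralLinearGroup.det_surjective, Subgroup.card_top, Matrix.card_GL_field,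
    ← Nat.card_congr (MonoidHom.ofInjective Matrix.SpecialLinearGroup.toGL_injective).toEquiv,
    Nat.card_units, Nat.card_eq_fintype_card (α := F), Fin.prod_univ_two] at hcard
  have hq : 1 < Fintype.card F := Fintype.one_lt_card
  refine Nat.eq_of_mul_eq_mul_right (Nat.sub_pos_of_lt hq) (hcard.trans ?_)
  rw [Fin.val_zero, Fin.val_one, pow_zero, pow_one, sq, ← Nat.mul_sub_one]
  ring

theorem FiniteField.two_ne_zero_of_odd_card {F : Type*} [Field F] [Fintype F]
    (hq : Odd (Fintype.card F)) : (2 : F) ≠ 0 :=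
  Ring.two_ne_zero fun h ↦
    Nat.not_even_iff_odd.mpr hq (Nat.even_iff.mpr (FiniteField.even_card_of_char_two h))

/-- The elements of an extension of a finite field fixed by Frobenius lie in the base field. -/
theorem FiniteField.mem_range_algebraMap_of_pow_card_eq {F K : Type*} [Field F] [Fintype F]
    [Field K] [Algebra F K] {a : K} (ha : a ^ Fintype.card F = a) :
    a ∈ (algebraMap F K).range := by
  open Polynomial in
  have hsplits : (X ^ Fintype.card F - X : F[X]).Splits := by
    rw [splits_iff_card_roots, FiniteField.roots_X_pow_card_sub_X,
      FiniteField.X_pow_card_sub_X_natDegree_eq F Fintype.one_lt_card, Finset.card_val,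
      Finset.card_univ]
  exact hsplits.mem_range_of_isRoot (FiniteField.X_pow_card_sub_X_ne_zero F Fintype.one_lt_card)
    (by simp [ha])

theorem Nat.two_pow_succ_dvd_sub_one_or_add_one {q k : ℕ} (hq : Odd q)
    (h : 2 ^ (k + 2) ∣ q ^ 2 - 1) : 2 ^ (k + 1) ∣ q - 1 ∨ 2 ^ (k + 1) ∣ q + 1 := by
  obtain ⟨a, rfl⟩ := hq
  have hfac : (2 * a + 1) ^ 2 - 1 = 4 * (a * (a + 1)) := by
    rw [Nat.sub_eq_iff_eq_add (Nat.one_le_pow _ _ (by omega))]; ring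
  rw [hfac, pow_add, mul_comm, show 2 ^ 2 = 4 from rfl, Nat.mul_dvd_mul_iff_left (by norm_num)] at h
  rcases k.eq_zero_or_pos with rfl | hk
  · left; simp
  have hpp : IsPrimePow (2 ^ k) := Nat.prime_two.isPrimePow.pow hk.ne'
  rw [pow_succ', show 2 * a + 1 - 1 = 2 * a by omega, show 2 * a + 1 + 1 = 2 * (a + 1) by ring]
  exact (((Nat.coprime_self_add_right.mpr (by simp)).isPrimePow_dvd_mul hpp).mp h).imp
    (mul_dvd_mul_left 2) (mul_dvd_mul_left 2)

open Matrix in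
/-- If `z` is an eigenvalue of the companion matrix of `X ^ 2 - t * X + 1`, then a power of this
matrix is `-1` as soon as the same power of `z` is. -/
theorem Matrix.companion_pow_eq_neg_one {F K : Type*} [Field F] [Field K] [Algebra F K]
    {t : F} {z : K} {k : ℕ} (ht : algebraMap F K t = z + z⁻¹) (hz : z ≠ 0) (hz' : z ≠ z⁻¹)
    (hk : z ^ k = -1) :
    (!![0, -1; 1, t] : Matrix (Fin 2) (Fin 2) F) ^ k = -1 := by
  let V : Matrix (Fin 2) (Fin 2) K := !![1, 1; -z, -z⁻¹]
  let A : Matrix (Fin 2) (Fin 2) F := !![0, -1; 1, t]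
  have hV : IsUnit V := by
    rw [isUnit_iff_isUnit_det, isUnit_iff_ne_zero]
    simp only [V, det_fin_two_of]
    intro h
    exact hz' (by linear_combination h)
  have hsc : SemiconjBy V (diagonal ![z, z⁻¹]) ((algebraMap F K).mapMatrix A) := by
    ext i j
    fin_cases i <;> fin_cases j <;> simp [V, A, mul_apply, Fin.sum_univ_two, ht] <;>
      field_simp <;> ring
  have hD : (diagonal ![z, z⁻¹]) ^ k = (-1 : Matrix (Fin 2) (Fin 2) K) := by
    rw [diagonal_pow]
    ext i j
    fin_cases i <;> fin_cases j <;> simp [hk]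
  have h := hsc.pow_right k
  rw [hD, SemiconjBy, mul_neg_one, ← neg_one_mul, ← map_pow] at h
  have h' := hV.mul_right_cancel h
  apply Matrix.map_injective (algebraMap F K).injective
  change (algebraMap F K).mapMatrix (A ^ k) = (algebraMap F K).mapMatrix (-1)
  rw [← h', map_neg, map_one]

theorem FiniteField.exists_sq_add_mul_add_sq_eq_neg_one {F : Type*} [Field F] [Fintype F]
    (hq : Odd (Fintype.card F)) {t : F} (ht : t ^ 2 ≠ 4) :
    ∃ a c : F, a ^ 2 + t * a * c + c ^ 2 = -1 := by
  have h2 : (2 : F) ≠ 0 := FiniteField.two_ne_zero_of_odd_card hq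
  have h4 : (4 : F) ≠ 0 := by
    rw [show (4 : F) = 2 * 2 by norm_num]
    exact mul_ne_zero h2 h2
  have hlead : 1 - t ^ 2 / 4 ≠ 0 := by
    intro h
    field_simp at h
    exact ht (by linear_combination -h)
  open Polynomial in
  obtain ⟨u, c, h⟩ := FiniteField.exists_root_sum_quadratic (R := F) (f := X ^ 2)
    (g := C (1 - t ^ 2 / 4) * X ^ 2 + C 0 * X + C 1) (degree_X_pow 2) (degree_quadratic hlead)
    (Nat.odd_iff.mp hq)
  refine ⟨u - t * c / 2, c, ?_⟩
  simp only [eval_pow, eval_X, eval_add, eval_mul, eval_C, zero_mul, add_zero] at h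
  field_simp at h ⊢
  linear_combination h

open Matrix in
/-- `SL₂(F_q)` contains a pair of generators of a generalized quaternion group of order
`2 ^ (k + 2)` whenever `2 ^ (k + 1)` divides `q - 1` or `q + 1`. -/
theorem Matrix.SpecialLinearGroup.exists_quaternion_generators {F : Type*} [Field F] [Fintype F]
    (hq : Odd (Fintype.card F)) {k : ℕ} (hk : 1 ≤ k) (hdvd : 2 ^ (k + 1) ∣ Fintype.card F - 1 ∨
      2 ^ (k + 1) ∣ Fintype.card F + 1) :
    ∃ x y : SpecialLinearGroup (Fin 2) F, orderOf x = 2 * 2 ^ k ∧ y ^ 2 = x ^ 2 ^ k ∧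
      y * x * y⁻¹ = x⁻¹ := by
  have h2 : (2 : F) ≠ 0 := FiniteField.two_ne_zero_of_odd_card hq
  let K := AlgebraicClosure F
  have : NeZero ((2 : ℕ) : F) := ⟨by simpa using h2⟩
  obtain ⟨z, hz⟩ := HasEnoughRootsOfUnity.exists_primitiveRoot K (2 ^ (k + 1))
  have hz0 : z ≠ 0 := hz.ne_zero (by positivity)
  have hzk : z ^ 2 ^ k = -1 := by
    have h := hz.pow (by positivity) (pow_succ 2 k)
    exact h.eq_neg_one_of_two_right
  have hzinv : z ≠ z⁻¹ := by
    intro h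
    have h1 : z ^ 2 = 1 := by rw [sq]; nth_rewrite 1 [h]; exact inv_mul_cancel₀ hz0
    have := Nat.le_of_dvd two_pos ((hz.pow_eq_one_iff_dvd 2).mp h1)
    have := Nat.pow_le_pow_right two_pos (Nat.succ_le_succ hk)
    omega
  obtain ⟨t, ht⟩ : z + z⁻¹ ∈ (algebraMap F K).range := by
    apply FiniteField.mem_range_algebraMap_of_pow_card_eq
    have hadd : (z + z⁻¹) ^ Fintype.card F = z ^ Fintype.card F + (z ^ Fintype.card F)⁻¹ := by
      simpa using map_add (FiniteField.frobeniusAlgHom F K) z z⁻¹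
    rw [hadd]
    rcases hdvd with hdvd | hdvd
    · have h := (hz.pow_eq_one_iff_dvd _).mpr hdvd
      rw [show z ^ Fintype.card F = z by
        rw [← Nat.sub_add_cancel (Fintype.card_pos (α := F)), pow_succ, h, one_mul]]
    · have h := (hz.pow_eq_one_iff_dvd _).mpr hdvd
      rw [eq_inv_of_mul_eq_one_left ((pow_succ z _).symm.trans h), inv_inv, add_comm]
  have ht4 : t ^ 2 ≠ 4 := by
    intro h
    have h' : (z + z⁻¹) ^ 2 = 4 := by rw [← ht, ← map_pow, h, map_ofNat]
    refine hzinv (sub_eq_zero.mp (pow_eq_zero_iff two_ne_zero |>.mp ?_))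
    linear_combination h' - 4 * mul_inv_cancel₀ hz0
  obtain ⟨a, c, hac⟩ := FiniteField.exists_sq_add_mul_add_sq_eq_neg_one hq ht4
  obtain ⟨x, hxA⟩ : ∃ x : SpecialLinearGroup (Fin 2) F,
      (x : Matrix (Fin 2) (Fin 2) F) = !![0, -1; 1, t] :=
    ⟨⟨!![0, -1; 1, t], by simp [det_fin_two_of]⟩, rfl⟩
  obtain ⟨y, hyA⟩ : ∃ y : SpecialLinearGroup (Fin 2) F,
      (y : Matrix (Fin 2) (Fin 2) F) = !![a, c + a * t; c, -a] :=
    ⟨⟨!![a, c + a * t; c, -a], by rw [det_fin_two_of]; linear_combination -hac⟩, rfl⟩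
  have hx : x ^ 2 ^ k = -1 := Subtype.ext <| by
    simpa [hxA] using Matrix.companion_pow_eq_neg_one ht hz0 hzinv hzk
  have hne : (-1 : SpecialLinearGroup (Fin 2) F) ≠ 1 := by
    intro h
    have h : (-1 : F) = 1 := by
      simpa using congrArg (fun g : SpecialLinearGroup (Fin 2) F ↦ g 0 0) h
    exact h2 (by linear_combination -h)
  refine ⟨x, y, ?_, ?_, ?_⟩
  · rw [← pow_succ']
    exact orderOf_eq_prime_pow (by rwa [hx]) (by rw [pow_succ, pow_mul, hx, neg_one_sq])
  · rw [hx, sq]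
    apply Subtype.ext
    rw [SpecialLinearGroup.coe_mul, hyA, mul_fin_two, SpecialLinearGroup.coe_neg,
      SpecialLinearGroup.coe_one]
    ext i j
    fin_cases i <;> fin_cases j <;> simp <;> first | ring1 | linear_combination hac
  · rw [mul_inv_eq_iff_eq_mul, eq_inv_mul_iff_mul_eq]
    apply Subtype.ext
    rw [SpecialLinearGroup.coe_mul, SpecialLinearGroup.coe_mul, hxA, hyA, mul_fin_two, mul_fin_two]
    ext i j
    fin_cases i <;> fin_cases j <;> simp <;> ring

/-- For `q` an odd prime power, the Sylow 2-subgroups of `SL₂(F_q)` are generalized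
quaternion groups (here `Q_{2^m}`, `m ≥ 3`, is realized as `QuaternionGroup (2 ^ (m - 2))`,
which has order `2 ^ m`). -/
theorem sylow_two_SL2_isQuaternion (F : Type) [Field F] [Fintype F]
    (hq : Odd (Fintype.card F))
    (P : Sylow 2 (Matrix.SpecialLinearGroup (Fin 2) F)) :
    ∃ m : ℕ, 3 ≤ m ∧
      Nonempty (↥(P : Subgroup (Matrix.SpecialLinearGroup (Fin 2) F)) ≃*
        QuaternionGroup (2 ^ (m - 2))) := by
  have : Fact (Nat.Prime 2) := ⟨Nat.prime_two⟩
  have hcard := Matrix.SpecialLinearGroup.card_fin_two F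
  set G := Matrix.SpecialLinearGroup (Fin 2) F
  set m := (Nat.card G).factorization 2 with hm
  have hm_dvd : 2 ^ m ∣ Fintype.card F ^ 2 - 1 := by
    refine (Nat.Coprime.pow_left m (Nat.coprime_two_left.mpr hq)).dvd_of_dvd_mul_left ?_
    rw [← hcard]
    exact Nat.ordProj_dvd _ _
  have hm3 : 3 ≤ m := by
    rw [hm, ← Nat.prime_two.pow_dvd_iff_le_factorization Nat.card_pos.ne', hcard]
    exact (Nat.eight_dvd_sq_sub_one_of_odd hq).mul_left _
  obtain ⟨k, hk⟩ : ∃ k, m = k + 2 := ⟨m - 2, by omega⟩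
  refine ⟨m, hm3, ?_⟩
  rw [show m - 2 = k by omega]
  obtain ⟨x, y, hx, hy, hxy⟩ := Matrix.SpecialLinearGroup.exists_quaternion_generators hq
    (show 1 ≤ k by omega) (Nat.two_pow_succ_dvd_sub_one_or_add_one hq (hk ▸ hm_dvd))
  obtain ⟨f, hf⟩ := QuaternionGroup.exists_injective_monoidHom
    (Nat.one_lt_two_pow (by omega)) hx hy hxy
  have hrange : Nat.card f.range = 2 ^ m := by
    rw [← Nat.card_congr (MonoidHom.ofInjective hf).toEquiv, Nat.card_eq_fintype_card,
      QuaternionGroup.card, hk]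
    ring
  exact ⟨(P.equiv (Sylow.ofCard f.range hrange)).trans (MonoidHom.ofInjective hf).symm⟩
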